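/- For every ε > 0 and every g ∈ D(A*) one has ‖Γ₀ε g − Γ₀ g‖ ≤ ε·(C + b)·(‖g‖ + C·‖A* g‖), where Γ₀ g := g − B(A* g) and Γ₀ε g := Υε g − B(A*(Υε g)). -/

import Mathlib

open Complex Filter
open scoped ComplexInnerProductSpace

noncomputable section

variable {H : Type*} [NormedAddCommGroup H] [InnerProductSpace ℂ H] [CompleteSpace H]

/-- The eigenspace `ker (T - z·1)` of a partially defined linear operator `T`. -/
def pKer (T : H →ₗ.[ℂ] H) (z : ℂ) : Submodule ℂ H where
  carrier := {u : H | ∃ hu : u ∈ T.domain, T ⟨u, hu⟩ = z • u}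
  zero_mem' := ⟨T.domain.zero_mem, by
    have h0 : (⟨0, T.domain.zero_mem⟩ : T.domain) = 0 := rfl
    rw [h0, T.map_zero, smul_zero]⟩
  add_mem' := by
    rintro a b ⟨ha, hTa⟩ ⟨hb, hTb⟩
    refine ⟨T.domain.add_mem ha hb, ?_⟩
    have h : (⟨a + b, T.domain.add_mem ha hb⟩ : T.domain) = ⟨a, ha⟩ + ⟨b, hb⟩ := rfl
    rw [h, T.map_add, hTa, hTb, smul_add]
  smul_mem' := by
    rintro c a ⟨ha, hTa⟩
    refine ⟨T.domain.smul_mem c ha, ?_⟩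
    have h : (⟨c • a, T.domain.smul_mem c ha⟩ : T.domain) = c • (⟨a, ha⟩ : T.domain) := rfl
    rw [h, T.map_smul, hTa, smul_comm]

/-- Orthogonal projection onto a closed submodule, as a map `H →L[ℂ] H`. -/
def projCl (W : Submodule ℂ H) (hW : IsClosed (W : Set H)) : H →L[ℂ] H :=
  letI : CompleteSpace W := hW.completeSpace_coe
  W.subtypeL.comp (W.orthogonalProjectionOnto)

/-- The boundary map `Γ₁ε⁻ g = P_{ker(T - iε)} (T g + iε g)`. -/
def Gamma1m (T : H →ₗ.[ℂ] H) (hker : ∀ z : ℂ, IsClosed ((pKer T z : Set H)))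
    (ε : ℝ) (g : T.domain) : H :=
  projCl (pKer T ((ε : ℂ) * I)) (hker _) (T g + ((ε : ℂ) * I) • (g : H))

/-- The boundary map `Γ₁ε⁺ g = P_{ker(T + iε)} (T g - iε g)`. -/
def Gamma1p (T : H →ₗ.[ℂ] H) (hker : ∀ z : ℂ, IsClosed ((pKer T z : Set H)))
    (ε : ℝ) (g : T.domain) : H :=
  projCl (pKer T (-((ε : ℂ) * I))) (hker _) (T g - ((ε : ℂ) * I) • (g : H))

/-- The map `Υε g = (2iε)⁻¹ (Γ₁ε⁻ g - Γ₁ε⁺ g)`. -/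
def Ups (T : H →ₗ.[ℂ] H) (hker : ∀ z : ℂ, IsClosed ((pKer T z : Set H)))
    (ε : ℝ) (g : T.domain) : H :=
  (2 * (ε : ℂ) * I)⁻¹ • (Gamma1m T hker ε g - Gamma1p T hker ε g)

/-- For symmetric `A`, adding an imaginary multiple of the identity does not decrease `‖A f‖`. -/
lemma norm_apply_le_norm_apply_add_I_smul (A : H →ₗ.[ℂ] H)
    (hsym : ∀ f g : A.domain, ⟪(f : H), (A g : H)⟫ = ⟪(A f : H), (g : H)⟫)
    (c : ℝ) (f : A.domain) : ‖A f‖ ≤ ‖A f + ((c : ℂ) * I) • (f : H)‖ := by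
  have him : (⟪(A f : H), (f : H)⟫).im = 0 := by
    have h := inner_conj_symm (𝕜 := ℂ) (A f) (f : H)
    rw [hsym f f] at h
    exact Complex.conj_eq_iff_im.mp h
  have hre : RCLike.re ⟪(A f : H), ((c : ℂ) * I) • (f : H)⟫ = 0 := by
    rw [inner_smul_right]
    simp [him]
  have h := norm_add_sq (𝕜 := ℂ) (A f) (((c : ℂ) * I) • (f : H))
  rw [hre] at h
  refine le_of_sq_le_sq ?_ (norm_nonneg _)
  nlinarith [sq_nonneg ‖((c : ℂ) * I) • (f : H)‖]

/-- The map `(f, A f) ↦ A f + z f` on the graph of `A`. -/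
def graphShift (A : H →ₗ.[ℂ] H) (z : ℂ) : A.graph →L[ℂ] H :=
  (ContinuousLinearMap.snd ℂ H H + z • ContinuousLinearMap.fst ℂ H H).comp A.graph.subtypeL

lemma graphShift_apply (A : H →ₗ.[ℂ] H) (z : ℂ) (p : A.graph) :
    graphShift A z p = (p : H × H).2 + z • (p : H × H).1 := rfl

lemma isClosed_range_graphShift (A : H →ₗ.[ℂ] H) (hclosed : A.IsClosed)
    (hsym : ∀ f g : A.domain, ⟪(f : H), (A g : H)⟫ = ⟪(A f : H), (g : H)⟫)
    (C : ℝ) (hC : 0 < C) (hbound : ∀ f : A.domain, ‖(f : H)‖ ≤ C * ‖A f‖) (c : ℝ) :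
    IsClosed ((graphShift A ((c : ℂ) * I)).range : Set H) := by
  have : CompleteSpace A.graph := IsClosed.completeSpace_coe (hs := hclosed)
  have hanti : AntilipschitzWith (1 + C).toNNReal (graphShift A ((c : ℂ) * I)) := by
    refine AddMonoidHomClass.antilipschitz_of_bound _ ?_
    rintro ⟨⟨x, y⟩, hp⟩
    obtain ⟨f, rfl, rfl⟩ := (LinearPMap.mem_graph_iff A).mp hp
    have h := norm_apply_le_norm_apply_add_I_smul A hsym c f
    rw [Real.coe_toNNReal _ (by positivity), graphShift_apply]
    refine (max_le ?_ ?_ : ‖((f : H), A f)‖ ≤ _)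
    · have := hbound f
      dsimp only
      nlinarith [norm_nonneg (A f)]
    · dsimp only
      nlinarith [norm_nonneg (A f)]
  exact hanti.isClosed_range (graphShift A ((c : ℂ) * I)).uniformContinuous

lemma orthogonal_range_graphShift_le (A : H →ₗ.[ℂ] H) (hdense : Dense (A.domain : Set H)) (z : ℂ) :
    (graphShift A z).rangeᗮ ≤ pKer A.adjoint (-(starRingEnd ℂ z)) := by
  intro x hx
  have key : ∀ f : A.domain, ⟪-(starRingEnd ℂ z) • x, (f : H)⟫ = ⟪x, A f⟫ := by
    intro f
    have h := (Submodule.mem_orthogonal' _ _).mp hx _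
      ⟨⟨((f : H), A f), A.mem_graph f⟩, rfl⟩
    erw [graphShift_apply] at h
    rw [inner_add_right, inner_smul_right] at h
    rw [inner_smul_left]
    simp only [map_neg, Complex.conj_conj]
    linear_combination -h
  exact ⟨LinearPMap.mem_adjoint_domain_of_exists _ ⟨_, key⟩,
    LinearPMap.adjoint_apply_eq hdense _ key⟩

lemma inner_pKer_adjoint_eq_zero (A : H →ₗ.[ℂ] H) (hdense : Dense (A.domain : Set H)) (z : ℂ)
    {x : H} (hx : x ∈ pKer A.adjoint (-(starRingEnd ℂ z))) (f : A.domain) :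
    ⟪x, A f + z • (f : H)⟫ = 0 := by
  obtain ⟨hx, hTx⟩ := hx
  have h := LinearPMap.adjoint_isFormalAdjoint hdense ⟨x, hx⟩ f
  rw [hTx, inner_smul_left] at h
  rw [inner_add_right, inner_smul_right]
  simp only [map_neg, Complex.conj_conj] at h
  linear_combination -h

lemma projCl_mem (W : Submodule ℂ H) (hW : IsClosed (W : Set H)) (x : H) : projCl W hW x ∈ W :=
  Subtype.property _

lemma sub_projCl_mem_orthogonal (W : Submodule ℂ H) (hW : IsClosed (W : Set H)) (x : H) :
    x - projCl W hW x ∈ Wᗮ :=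
  letI : CompleteSpace W := hW.completeSpace_coe
  W.sub_starProjection_mem_orthogonal x

lemma projCl_eq (W : Submodule ℂ H) (hW : IsClosed (W : Set H)) {x y : H} (hy : y ∈ W)
    (hxy : x - y ∈ Wᗮ) : projCl W hW x = y :=
  letI : CompleteSpace W := hW.completeSpace_coe
  Submodule.eq_starProjection_of_mem_orthogonal hy hxy

lemma mem_pKer_iff_mem_graph (T : H →ₗ.[ℂ] H) (z : ℂ) (x : H) :
    x ∈ pKer T z ↔ (x, z • x) ∈ T.graph := by
  rw [LinearPMap.mem_graph_iff]
  constructor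
  · rintro ⟨hx, h⟩
    exact ⟨⟨x, hx⟩, rfl, h⟩
  · rintro ⟨y, rfl, h⟩
    exact ⟨y.2, h⟩

/-- Von Neumann's decomposition: `g - Υε g` lies in the domain of `A`. -/
lemma exists_Ups_eq_sub (A : H →ₗ.[ℂ] H) (hdense : Dense (A.domain : Set H))
    (hclosed : A.IsClosed)
    (hsym : ∀ f g : A.domain, ⟪(f : H), (A g : H)⟫ = ⟪(A f : H), (g : H)⟫)
    (C : ℝ) (hC : 0 < C) (hbound : ∀ f : A.domain, ‖(f : H)‖ ≤ C * ‖A f‖)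
    (hker : ∀ z : ℂ, IsClosed ((pKer A.adjoint z : Set H)))
    (hle : A ≤ A.adjoint) (ε : ℝ) (hε : 0 < ε) (g : A.adjoint.domain) :
    ∃ f : A.domain, Ups A.adjoint hker ε g = (g : H) - f := by
  set z : ℂ := (ε : ℂ) * I with hz
  have hz0 : z ≠ 0 := mul_ne_zero (by exact_mod_cast hε.ne') I_ne_zero
  have hconj : -(starRingEnd ℂ z) = z := by simp [hz]
  have hconj' : -(starRingEnd ℂ (-z)) = -z := by simp [hz]
  have hp := projCl_mem _ (hker z) (A.adjoint g + z • (g : H))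
  have hwp := sub_projCl_mem_orthogonal _ (hker z) (A.adjoint g + z • (g : H))
  have hm : Gamma1m A.adjoint hker ε g = projCl _ (hker z) (A.adjoint g + z • (g : H)) := rfl
  rw [← hm] at hp hwp
  set p := Gamma1m A.adjoint hker ε g
  obtain ⟨f, hf⟩ : ∃ f : A.domain, A f + z • (f : H) = A.adjoint g + z • (g : H) - p := by
    have hR := isClosed_range_graphShift A hclosed hsym C hC hbound ε
    have : CompleteSpace (graphShift A z).range := hR.completeSpace_coe
    have hK := orthogonal_range_graphShift_le A hdense z
    rw [hconj] at hK
    have h := Submodule.orthogonal_le hK hwp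
    rw [Submodule.orthogonal_orthogonal] at h
    obtain ⟨⟨⟨x, y⟩, hxy⟩, h⟩ := h
    obtain ⟨f, rfl, rfl⟩ := (LinearPMap.mem_graph_iff A).mp hxy
    exact ⟨f, h⟩
  set u : H := (2 * z)⁻¹ • p with hu
  set v : H := (g : H) - f - u with hv
  have hpu : p = (2 * z) • u := (smul_inv_smul₀ (mul_ne_zero two_ne_zero hz0) p).symm
  have hgr : A.adjoint g = A f - z • v + z • u := by
    have : A.adjoint g = A f + z • (f : H) + p - z • (g : H) := by rw [hf]; abel
    rw [this, hv, hpu]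
    module
  have huK : u ∈ pKer A.adjoint z := Submodule.smul_mem _ _ hp
  have hvK : v ∈ pKer A.adjoint (-z) := by
    rw [mem_pKer_iff_mem_graph] at huK ⊢
    have h := A.adjoint.graph.sub_mem (A.adjoint.graph.sub_mem (A.adjoint.mem_graph g)
      (LinearPMap.le_graph_of_le hle (A.mem_graph f))) huK
    convert h using 1
    refine Prod.ext rfl ?_
    change -z • v = A.adjoint g - A f - z • u
    rw [hgr]
    module
  have hq : Gamma1p A.adjoint hker ε g = -(2 * z) • v := by
    refine projCl_eq _ _ (Submodule.smul_mem _ _ hvK) ?_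
    have heq : A.adjoint g - z • (g : H) - -(2 * z) • v = A f + (-z) • (f : H) := by
      have hg : (g : H) = f + u + v := by rw [hv]; abel
      rw [hgr, hg]
      module
    rw [← hz, heq, Submodule.mem_orthogonal]
    intro x hx
    rw [← hconj'] at hx
    exact inner_pKer_adjoint_eq_zero A hdense (-z) hx f
  refine ⟨f, ?_⟩
  have hUps : Ups A.adjoint hker ε g = (2 * z)⁻¹ • (p - Gamma1p A.adjoint hker ε g) := by
    rw [hz, ← mul_assoc]; rfl
  have hsum : (2 * z) • u - -(2 * z) • v = (2 * z) • ((g : H) - f) := by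
    rw [hv]
    module
  rw [hUps, hq, hpu, hsum, inv_smul_smul₀ (mul_ne_zero two_ne_zero hz0)]

theorem statement_8
    (A : H →ₗ.[ℂ] H)
    (hdense : Dense (A.domain : Set H))
    (hclosed : A.IsClosed)
    (hsym : ∀ f g : A.domain, ⟪(f : H), (A g : H)⟫ = ⟪(A f : H), (g : H)⟫)
    (C : ℝ) (hC : 0 < C)
    (hbound : ∀ f : A.domain, ‖(f : H)‖ ≤ C * ‖A f‖)
    (hker : ∀ z : ℂ, IsClosed ((pKer A.adjoint z : Set H)))
    (SD : H →ₗ.[ℂ] H) (hSDsa : SD.adjoint = SD) (hASD : A ≤ SD)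
    (B : H →L[ℂ] H) (b : ℝ) (hb : ‖B‖ = b)
    (hB1 : ∀ x : SD.domain, B (SD x) = x)
    (hB2 : ∀ y : H, ∃ hy : B y ∈ SD.domain, SD ⟨B y, hy⟩ = y)
    (ε : ℝ) (hε : 0 < ε) (g : A.adjoint.domain)
    (hm : Ups A.adjoint hker ε g ∈ A.adjoint.domain) :
    ‖(Ups A.adjoint hker ε g - B (A.adjoint ⟨Ups A.adjoint hker ε g, hm⟩))
        - ((g : H) - B (A.adjoint g))‖
      ≤ ε * (C + b) * (‖(g : H)‖ + C * ‖A.adjoint g‖) := by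
  have hle : A ≤ A.adjoint :=
    LinearPMap.IsFormalAdjoint.le_adjoint hdense fun f g => (hsym f g).symm
  obtain ⟨f, hf⟩ :=
    exists_Ups_eq_sub A hdense hclosed hsym C hC hbound hker hle ε hε g
  have hBf : B (A f) = f := by
    rw [hASD.2 (x := f) (y := ⟨f, hASD.1 f.2⟩) rfl]
    exact hB1 _
  have hadj : A.adjoint ⟨Ups A.adjoint hker ε g, hm⟩ = A.adjoint g - A f := by
    have h : (⟨Ups A.adjoint hker ε g, hm⟩ : A.adjoint.domain) = g - ⟨f, hle.1 f.2⟩ :=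
      Subtype.ext hf
    rw [h, LinearPMap.map_sub, ← hle.2 (x := f) (y := ⟨f, hle.1 f.2⟩) rfl]
  have hzero : (Ups A.adjoint hker ε g - B (A.adjoint ⟨Ups A.adjoint hker ε g, hm⟩))
      - ((g : H) - B (A.adjoint g)) = 0 := by
    rw [hadj, map_sub, hBf, hf]
    abel
  have hb0 : 0 ≤ b := hb ▸ norm_nonneg B
  rw [hzero, norm_zero]
  positivity
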